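/- arXiv:2303.00547 — 7 statements merged into one kernel-verified Lean document; each statement's English description precedes it below -/
import Mathlib

section
/- For every order tree T, the collection S = {[t] : t ∈ T} of subsets of the ray space R(T) is noetherian, i.e., every ⊆-increasing sequence of members of S is eventually constant. -/
open Set Topology

universe u v

/-- An order tree: a partial order with a minimum element (the root) in which
the set of predecessors of every element is a well-ordered chain. -/
def IsOrderTree (T : Type u) [PartialOrder T] : Prop :=
  (∃ r : T, ∀ t : T, r ≤ t) ∧
    ∀ t : T, IsChain (· ≤ ·) (Set.Iic t) ∧ (Set.Iic t).IsWF

/-- A tree is special if it is the union of countably many antichains. -/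
def IsSpecialTree (T : Type u) [PartialOrder T] : Prop :=
  ∃ A : ℕ → Set T, (∀ n, IsAntichain (· ≤ ·) (A n)) ∧ (⋃ n, A n) = Set.univ

/-- A path of `T`: a down-closed chain. -/
def IsPath {T : Type u} [PartialOrder T] (x : Set T) : Prop :=
  IsChain (· ≤ ·) x ∧ ∀ ⦃s t : T⦄, s ≤ t → t ∈ x → s ∈ x

/-- A ray: a path with no maximal element. -/
def IsRay {T : Type u} [PartialOrder T] (x : Set T) : Prop :=
  IsPath x ∧ ∀ t ∈ x, ∃ s ∈ x, t < s

/-- A branch: an inclusion-wise maximal path. -/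
def IsBranch {T : Type u} [PartialOrder T] (x : Set T) : Prop :=
  IsPath x ∧ ∀ y : Set T, IsPath y → x ⊆ y → y = x

/-- The product topology of `2^T`, transported to `Set T` via characteristic
functions: it is generated by the sets `{s | t ∈ s}` and their complements. -/
def cylinderTopology (T : Type u) : TopologicalSpace (Set T) :=
  TopologicalSpace.generateFrom
    {C : Set (Set T) | ∃ t : T, C = {s : Set T | t ∈ s} ∨ C = {s : Set T | t ∉ s}}

/-- The path space `P(T)`. -/
def PathSpace (T : Type u) [PartialOrder T] : Type u := {x : Set T // IsPath x}

/-- The ray space `R(T)`. -/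
def RaySpace (T : Type u) [PartialOrder T] : Type u := {x : Set T // IsRay x}

/-- The branch space `B(T)`. -/
def BranchSpace (T : Type u) [PartialOrder T] : Type u := {x : Set T // IsBranch x}

instance PathSpace.topologicalSpace (T : Type u) [PartialOrder T] :
    TopologicalSpace (PathSpace T) :=
  TopologicalSpace.induced (fun x => x.1) (cylinderTopology T)

instance RaySpace.topologicalSpace (T : Type u) [PartialOrder T] :
    TopologicalSpace (RaySpace T) :=
  TopologicalSpace.induced (fun x => x.1) (cylinderTopology T)

instance BranchSpace.topologicalSpace (T : Type u) [PartialOrder T] :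
    TopologicalSpace (BranchSpace T) :=
  TopologicalSpace.induced (fun x => x.1) (cylinderTopology T)

/-- The subbasic set `[t] = {x ∈ R(T) : t ∈ x}`. -/
def raySet {T : Type u} [PartialOrder T] (t : T) : Set (RaySpace T) := {x | t ∈ x.1}

/-- The basic set `[t] = {x ∈ B(T) : t ∈ x}`. -/
def branchSet {T : Type u} [PartialOrder T] (t : T) : Set (BranchSpace T) := {x | t ∈ x.1}

/-- A top of a ray `x` is a node whose set of strict predecessors is exactly `x`. -/
def IsTopOf {T : Type u} [PartialOrder T] (t : T) (x : Set T) : Prop := Set.Iio t = x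

/-- `s` is a successor of `t`. -/
def IsSuccessorOf {T : Type u} [PartialOrder T] (s t : T) : Prop :=
  t < s ∧ ∀ u : T, t < u → u < s → False

/-- A tree is pruned if every node has a successor. -/
def IsPruned (T : Type u) [PartialOrder T] : Prop := ∀ t : T, ∃ s : T, IsSuccessorOf s t

/-- A family of sets is nested if any two intersecting members are ⊆-comparable. -/
def NestedFam {X : Type v} (𝒜 : Set (Set X)) : Prop :=
  ∀ A ∈ 𝒜, ∀ B ∈ 𝒜, (A ∩ B).Nonempty → A ⊆ B ∨ B ⊆ A

/-- A family of sets is noetherian if every ⊆-increasing sequence of its members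
is eventually constant. -/
def NoetherianFam {X : Type v} (𝒜 : Set (Set X)) : Prop :=
  ∀ f : ℕ → Set X, (∀ n, f n ∈ 𝒜) → Monotone f → ∃ N, ∀ n, N ≤ n → f n = f N

/-- A family of sets is centered if every finite subfamily has nonempty intersection. -/
def CenteredFam {X : Type v} (𝒜 : Set (Set X)) : Prop :=
  ∀ F : Finset (Set X), ↑F ⊆ 𝒜 → (⋂₀ (F : Set (Set X))).Nonempty

/-- A family of sets is complete if every centered subfamily has nonempty intersection. -/
def CompleteFam {X : Type v} (𝒜 : Set (Set X)) : Prop :=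
  ∀ 𝒞 ⊆ 𝒜, CenteredFam 𝒞 → (⋂₀ 𝒞).Nonempty

/-- A family is hereditarily complete if its trace on every closed set is complete. -/
def HeredCompleteFam {X : Type v} [TopologicalSpace X] (𝒜 : Set (Set X)) : Prop :=
  ∀ Y : Set X, IsClosed Y → CompleteFam {B : Set X | ∃ A ∈ 𝒜, B = A ∩ Y}

/-- A family is σ-disjoint if it is a countable union of pairwise disjoint subfamilies. -/
def SigmaDisjointFam {X : Type v} (𝒜 : Set (Set X)) : Prop :=
  ∃ D : ℕ → Set (Set X), (∀ n, (D n).Pairwise Disjoint) ∧ (⋃ n, D n) = 𝒜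

/-- `S` is a clopen subbase for `X` if the topology of `X` is the coarsest one in which
every member of `S` is clopen, i.e. it is generated by `S` together with the complements
of members of `S`. -/
def IsClopenSubbase {X : Type v} [t : TopologicalSpace X] (S : Set (Set X)) : Prop :=
  t = TopologicalSpace.generateFrom (S ∪ {B : Set X | ∃ A ∈ S, B = Aᶜ})

/-- `B` is a base for the topology of `X`. -/
def IsBaseFam {X : Type v} [TopologicalSpace X] (B : Set (Set X)) : Prop :=
  (∀ U ∈ B, IsOpen U) ∧ ∀ U : Set X, IsOpen U → ∀ x ∈ U, ∃ V ∈ B, x ∈ V ∧ V ⊆ U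
/-- For every order tree `T`, the collection `S = {[t] : t ∈ T}` of
subsets of the ray space `R(T)` is noetherian. -/
theorem stmt1 {T : Type u} [PartialOrder T] (hT : IsOrderTree T) :
    NoetherianFam {A : Set (RaySpace T) | ∃ t : T, A = raySet t} := by
  intro f hf hmono
  choose t ht using hf
  by_cases hne : ∃ m, (f m).Nonempty
  · obtain ⟨m, x, hx⟩ := hne
    have hmem : ∀ n, m ≤ n → t n ∈ x.1 := fun n hn => by
      have hxn : x ∈ f n := hmono hn hx
      rw [ht n] at hxn
      exact hxn
    have hwf : ({s | ∃ n, m ≤ n ∧ t n = s ∧ s ≤ t m} : Set T).IsWF :=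
      (hT.2 (t m)).2.mono fun s ⟨_, _, _, hs⟩ => hs
    have hnonempty : ({s | ∃ n, m ≤ n ∧ t n = s ∧ s ≤ t m} : Set T).Nonempty :=
      ⟨t m, m, le_rfl, rfl, le_rfl⟩
    obtain ⟨N, hmN, hN, hNm⟩ := hwf.min_mem hnonempty
    rw [← hN] at hNm
    refine ⟨N, fun n hn => ?_⟩
    have hmn : m ≤ n := hmN.trans hn
    refine (hmono hn).antisymm' ?_
    rw [ht n, ht N]
    rcases x.2.1.1.total (hmem n hmn) (hmem N hmN) with h | h
    · rcases h.lt_or_eq with h | h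
      · exact absurd (hN ▸ h) (hwf.not_lt_min hnonempty ⟨n, hmn, rfl, h.le.trans hNm⟩)
      · rw [h]
    · exact fun y hy => y.2.1.2 h hy
  · simp only [not_exists, not_nonempty_iff_eq_empty] at hne
    exact ⟨0, fun n _ => by rw [hne n, hne 0]⟩
end

section
/- For every order tree T, the family {[t] : t ∈ T} of clopen subsets of the branch space B(T) is a base of B(T) and is complete, i.e., every centered subfamily has nonempty intersection; consequently, every branch space B(T) is a Baire space. -/
open Set Topology

universe u v

/-- The set of predecessors of a node of an order tree is a path. -/
theorem IsOrderTree.isPath_Iic {T : Type u} [PartialOrder T] (hT : IsOrderTree T) (t : T) :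
    IsPath (Set.Iic t) :=
  ⟨(hT.2 t).1, fun _ _ hst ht => le_trans hst ht⟩

/-- Every path extends to a branch. -/
theorem IsPath.exists_isBranch_superset {T : Type u} [PartialOrder T] {p : Set T}
    (hp : IsPath p) : ∃ x : Set T, p ⊆ x ∧ IsBranch x := by
  obtain ⟨m, hpm, hm⟩ := zorn_subset_nonempty {x : Set T | IsPath x} (by
    intro c hc hchain _
    refine ⟨⋃₀ c, ⟨?_, ?_⟩, fun s hs => subset_sUnion_of_mem hs⟩
    · rintro a ⟨s, hs, has⟩ b ⟨t, ht, hbt⟩ hab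
      rcases hchain.total hs ht with h | h
      · exact (hc ht).1 (h has) hbt hab
      · exact (hc hs).1 has (h hbt) hab
    · rintro a b hab ⟨s, hs, hbs⟩
      exact ⟨s, hs, (hc hs).2 hab hbs⟩) p hp
  exact ⟨m, hpm, hm.prop, fun y hy hmy => (hm.eq_of_subset hy hmy).symm⟩

/-- The branches of an order tree are nonempty. -/
theorem IsBranch.nonempty {T : Type u} [PartialOrder T] (hT : IsOrderTree T) {x : Set T}
    (hx : IsBranch x) : x.Nonempty := by
  obtain ⟨r, -⟩ := hT.1
  by_contra h
  rw [not_nonempty_iff_eq_empty] at h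
  have := hx.2 _ (hT.isPath_Iic r) (by simp [h])
  have hr : r ∈ x := this ▸ mem_Iic.2 le_rfl
  simp [h] at hr

/-- A branch missing `s` contains a node that lies on no common path with `s`. -/
theorem IsBranch.exists_mem_forall_notMem {T : Type u} [PartialOrder T] (hT : IsOrderTree T)
    {x : Set T} (hx : IsBranch x) {s : T} (hs : s ∉ x) :
    ∃ t ∈ x, ∀ y : Set T, IsPath y → t ∈ y → s ∉ y := by
  have h : ¬ x ⊆ Set.Iic s := fun h =>
    hs (hx.2 _ (hT.isPath_Iic s) h ▸ mem_Iic.2 le_rfl)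
  obtain ⟨t, htx, hts⟩ := not_subset.1 h
  refine ⟨t, htx, fun y hy hty hsy => ?_⟩
  rcases hy.1.total hty hsy with h | h
  · exact hts h
  · exact hs (hx.1.2 h htx)

theorem isClopen_branchSet {T : Type u} [PartialOrder T] (t : T) :
    IsClopen (branchSet t) := by
  constructor
  · rw [← isOpen_compl_iff]
    exact ⟨{s | t ∉ s}, .basic _ ⟨t, .inr rfl⟩, rfl⟩
  · exact ⟨{s | t ∈ s}, .basic _ ⟨t, .inl rfl⟩, rfl⟩

theorem IsOrderTree.isBaseFam_branchSet {T : Type u} [PartialOrder T] (hT : IsOrderTree T) :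
    IsBaseFam {A : Set (BranchSpace T) | ∃ t : T, A = branchSet t} := by
  refine ⟨?_, ?_⟩
  · rintro _ ⟨t, rfl⟩
    exact (isClopen_branchSet t).isOpen
  rintro _ ⟨V, hV, rfl⟩ x hx
  suffices ∃ t ∈ x.1, ∀ y : BranchSpace T, t ∈ y.1 → y.1 ∈ V by
    obtain ⟨t, ht, h⟩ := this
    exact ⟨_, ⟨t, rfl⟩, ht, h⟩
  induction hV with
  | basic C hC =>
    obtain ⟨t, rfl | rfl⟩ := hC
    · exact ⟨t, hx, fun _ h => h⟩
    · obtain ⟨s, hs, h⟩ := x.2.exists_mem_forall_notMem hT hx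
      exact ⟨s, hs, fun y => h y.1 y.2.1⟩
  | univ =>
    obtain ⟨t, ht⟩ := x.2.nonempty hT
    exact ⟨t, ht, fun _ _ => trivial⟩
  | inter A B _ _ ihA ihB =>
    obtain ⟨a, ha, hA⟩ := ihA hx.1
    obtain ⟨b, hb, hB⟩ := ihB hx.2
    rcases x.2.1.1.total ha hb with h | h
    · exact ⟨b, hb, fun y hy => ⟨hA y (y.2.1.2 h hy), hB y hy⟩⟩
    · exact ⟨a, ha, fun y hy => ⟨hA y hy, hB y (y.2.1.2 h hy)⟩⟩
  | sUnion S _ ih =>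
    obtain ⟨A, hA, hxA⟩ := hx
    obtain ⟨t, ht, h⟩ := ih A hA hxA
    exact ⟨t, ht, fun y hy => ⟨A, hA, h y hy⟩⟩

theorem completeFam_branchSet {T : Type u} [PartialOrder T] :
    CompleteFam {A : Set (BranchSpace T) | ∃ t : T, A = branchSet t} := by
  classical
  intro 𝒞 h𝒞 hcent
  have hpath : IsPath {s : T | ∃ t, branchSet t ∈ 𝒞 ∧ s ≤ t} := by
    refine ⟨?_, fun s t hst ⟨u, hu, htu⟩ => ⟨u, hu, hst.trans htu⟩⟩
    rintro a ⟨s, hs, has⟩ b ⟨t, ht, hbt⟩ hab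
    obtain ⟨x, hx⟩ := hcent {branchSet s, branchSet t} (by
      simp [Set.insert_subset_iff, hs, ht])
    have hxs : s ∈ x.1 := hx (branchSet s) (by simp)
    have hxt : t ∈ x.1 := hx (branchSet t) (by simp)
    exact x.2.1.1 (x.2.1.2 has hxs) (x.2.1.2 hbt hxt) hab
  obtain ⟨x, hsub, hx⟩ := hpath.exists_isBranch_superset
  refine ⟨⟨x, hx⟩, fun A hA => ?_⟩
  obtain ⟨t, rfl⟩ := h𝒞 hA
  exact hsub ⟨t, hA, le_rfl⟩

/-- An antitone sequence of nonempty sets is a centered family. -/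
theorem centeredFam_range_of_antitone {X : Type v} {f : ℕ → Set X} (hf : Antitone f)
    (hne : ∀ n, (f n).Nonempty) : CenteredFam (Set.range f) := by
  classical
  intro F hF
  suffices ∃ N, ∀ A ∈ F, f N ⊆ A by
    obtain ⟨N, hN⟩ := this
    exact (hne N).mono (subset_sInter hN)
  induction F using Finset.induction_on with
  | empty => exact ⟨0, by simp⟩
  | insert A F _ ih =>
    rw [Finset.coe_insert, Set.insert_subset_iff] at hF
    obtain ⟨N, hN⟩ := ih hF.2
    obtain ⟨M, rfl⟩ := hF.1
    refine ⟨max M N, fun B hB => ?_⟩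
    rcases Finset.mem_insert.1 hB with rfl | hB
    · exact hf (le_max_left _ _)
    · exact (hf (le_max_right _ _)).trans (hN B hB)

/-- A space with a complete base is a Baire space. -/
theorem IsBaseFam.baireSpace {X : Type v} [TopologicalSpace X] {ℬ : Set (Set X)}
    (hbase : IsBaseFam ℬ) (hcomp : CompleteFam ℬ) : BaireSpace X := by
  refine ⟨fun U hUo hUd => dense_iff_inter_open.2 fun W hW hWne => ?_⟩
  obtain ⟨w, hw⟩ := hWne
  obtain ⟨V₀, hV₀, hwV₀, hV₀W⟩ := hbase.2 W hW w hw
  have step : ∀ (n : ℕ) (V : {V : Set X // V ∈ ℬ ∧ V.Nonempty}),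
      ∃ V' : {V : Set X // V ∈ ℬ ∧ V.Nonempty}, V'.1 ⊆ V.1 ∩ U n := by
    rintro n ⟨V, hV, hVne⟩
    obtain ⟨x, hx⟩ := (hUd n).inter_open_nonempty V (hbase.1 V hV) hVne
    obtain ⟨V', hV', hxV', hsub⟩ := hbase.2 _ ((hbase.1 V hV).inter (hUo n)) x hx
    exact ⟨⟨V', hV', x, hxV'⟩, hsub⟩
  choose next hnext using step
  let f : ℕ → {V : Set X // V ∈ ℬ ∧ V.Nonempty} :=
    fun n => Nat.rec ⟨V₀, hV₀, w, hwV₀⟩ next n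
  have hf : ∀ n, (f (n + 1)).1 ⊆ (f n).1 ∩ U n := fun n => hnext n (f n)
  have hanti : Antitone fun n => (f n).1 :=
    antitone_nat_of_succ_le fun n => (hf n).trans inter_subset_left
  obtain ⟨x, hx⟩ := hcomp (Set.range fun n => (f n).1)
    (by rintro _ ⟨n, rfl⟩; exact (f n).2.1)
    (centeredFam_range_of_antitone hanti fun n => (f n).2.2)
  have hxf : ∀ n, x ∈ (f n).1 := fun n => hx _ ⟨n, rfl⟩
  exact ⟨x, hV₀W (hxf 0), mem_iInter.2 fun n => (hf n (hxf (n + 1))).2⟩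

/-- For every order tree `T`, the family `{[t] : t ∈ T}` of clopen subsets
of the branch space `B(T)` is a base of `B(T)` and is complete; consequently, every
branch space is Baire. -/
theorem stmt2 {T : Type u} [PartialOrder T] (hT : IsOrderTree T) :
    (∀ t : T, IsClopen (branchSet t)) ∧
    IsBaseFam {A : Set (BranchSpace T) | ∃ t : T, A = branchSet t} ∧
    CompleteFam {A : Set (BranchSpace T) | ∃ t : T, A = branchSet t} ∧
    BaireSpace (BranchSpace T) :=
  ⟨isClopen_branchSet, hT.isBaseFam_branchSet, completeFam_branchSet,
    hT.isBaseFam_branchSet.baireSpace completeFam_branchSet⟩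
end

section
/- For every order tree T, the ray space R(T) is base-complete, i.e., it admits a base of open sets such that every centered subfamily of the base has nonempty intersection; consequently, every ray space R(T) is a Baire space. -/
open Set Topology

universe u v

/-- A space with a complete base is a Baire space. -/
theorem BaireSpace.of_completeFam {X : Type v} [TopologicalSpace X] {B : Set (Set X)}
    (hB : IsBaseFam B) (hc : CompleteFam B) : BaireSpace X := by
  refine ⟨fun f hfo hfd => dense_iff_inter_open.2 fun W hW hWne => ?_⟩
  have shrink : ∀ U : Set X, IsOpen U → U.Nonempty → ∃ V ∈ B, V.Nonempty ∧ V ⊆ U := by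
    rintro U hU ⟨x, hx⟩
    obtain ⟨V, hV, hxV, hVU⟩ := hB.2 U hU x hx
    exact ⟨V, hV, ⟨x, hxV⟩, hVU⟩
  have step : ∀ (n : ℕ) (V : {V : Set X // V ∈ B ∧ V.Nonempty}),
      ∃ V' : {V : Set X // V ∈ B ∧ V.Nonempty}, V'.1 ⊆ V.1 ∩ f n := by
    rintro n ⟨V, hV, hVne⟩
    obtain ⟨V', hV', hne, hsub⟩ := shrink (V ∩ f n) ((hB.1 V hV).inter (hfo n))
      ((hfd n).inter_open_nonempty V (hB.1 V hV) hVne)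
    exact ⟨⟨V', hV', hne⟩, hsub⟩
  choose next hnext using step
  obtain ⟨V₀, hV₀, hV₀ne, hV₀W⟩ := shrink W hW hWne
  let V : ℕ → {V : Set X // V ∈ B ∧ V.Nonempty} := fun n => Nat.rec ⟨V₀, hV₀, hV₀ne⟩ next n
  have hV : ∀ n, (V (n + 1)).1 ⊆ (V n).1 ∩ f n := fun n => hnext n (V n)
  have hanti : Antitone fun n => (V n).1 :=
    antitone_nat_of_succ_le fun n => (hV n).trans inter_subset_left
  obtain ⟨x, hx⟩ := hc (range fun n => (V n).1) (by rintro _ ⟨n, rfl⟩; exact (V n).2.1) (by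
    intro F hF
    have hbound : ∃ N, ∀ A ∈ F, (V N).1 ⊆ A := by
      choose! k hk using fun (A : Set X) (hA : A ∈ F) => hF hA
      refine ⟨F.sup k, fun A hA => ?_⟩
      rw [← hk A hA]
      exact hanti (Finset.le_sup hA)
    obtain ⟨N, hN⟩ := hbound
    exact (V N).2.2.mono (subset_sInter hN))
  have hxV : ∀ n, x ∈ (V n).1 := fun n => hx _ ⟨n, rfl⟩
  exact ⟨x, hV₀W (hxV 0), mem_iInter.2 fun n => (hV n (hxV (n + 1))).2⟩

theorem CenteredFam.inter_nonempty {X : Type v} {𝒞 : Set (Set X)} (h : CenteredFam 𝒞)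
    {U V : Set X} (hU : U ∈ 𝒞) (hV : V ∈ 𝒞) : (U ∩ V).Nonempty := by
  classical
  simpa using h {U, V} (by simp [insert_subset_iff, hU, hV])

section OrderTree

variable {T : Type u} [PartialOrder T]

theorem IsOrderTree.wellFounded_lt (hT : IsOrderTree T) :
    WellFounded ((· < ·) : T → T → Prop) := by
  rw [WellFounded.wellFounded_iff_has_min]
  rintro S ⟨a, ha⟩
  have hwf : (S ∩ Iic a).IsWF := (hT.2 a).2.mono inter_subset_right
  have hne : (S ∩ Iic a).Nonempty := ⟨a, ha, le_rfl⟩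
  refine ⟨hwf.min hne, (hwf.min_mem hne).1, fun b hb hlt => ?_⟩
  exact hwf.not_lt_min hne ⟨hb, hlt.le.trans (hwf.min_mem hne).2⟩ hlt

/-- The empty ray. -/
def emptyRay (T : Type u) [PartialOrder T] : RaySpace T :=
  ⟨∅, ⟨IsChain.empty, by simp⟩, by simp⟩

/-- The set of rays through `t` avoiding `F`. -/
def rayBasicSet (t : T) (F : Set T) : Set (RaySpace T) := {x | t ∈ x.1 ∧ ∀ s ∈ F, s ∉ x.1}

/-- The base of the ray space consisting of the singleton of the empty ray and the sets of rays
through a given node that avoid a given finite set of tops of rays. -/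
def rayBase (T : Type u) [PartialOrder T] : Set (Set (RaySpace T)) :=
  {V | V = {emptyRay T} ∨
    ∃ (t : T) (F : Set T), F.Finite ∧ (∀ s ∈ F, IsRay (Iio s)) ∧ V = rayBasicSet t F}

theorem raySpace_topology_eq : RaySpace.topologicalSpace T = TopologicalSpace.generateFrom
    {U : Set (RaySpace T) | ∃ t, U = raySet t ∨ U = (raySet t)ᶜ} := by
  unfold RaySpace.topologicalSpace cylinderTopology
  rw [induced_generateFrom_eq]
  congr 1
  ext U
  constructor
  · rintro ⟨_, ⟨t, rfl | rfl⟩, rfl⟩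
    exacts [⟨t, Or.inl rfl⟩, ⟨t, Or.inr rfl⟩]
  · rintro ⟨t, rfl | rfl⟩
    exacts [⟨_, ⟨t, Or.inl rfl⟩, rfl⟩, ⟨_, ⟨t, Or.inr rfl⟩, rfl⟩]

theorem isOpen_raySet (t : T) : IsOpen (raySet t) := by
  rw [raySpace_topology_eq]
  exact TopologicalSpace.isOpen_generateFrom_of_mem ⟨t, Or.inl rfl⟩

theorem isOpen_compl_raySet (t : T) : IsOpen (raySet t)ᶜ := by
  rw [raySpace_topology_eq]
  exact TopologicalSpace.isOpen_generateFrom_of_mem ⟨t, Or.inr rfl⟩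

theorem isOpen_rayBasicSet (t : T) {F : Set T} (hF : F.Finite) : IsOpen (rayBasicSet t F) := by
  have : rayBasicSet t F = raySet t ∩ ⋂ s ∈ F, (raySet s)ᶜ := by
    ext x
    simp [rayBasicSet, raySet]
  rw [this]
  exact (isOpen_raySet t).inter (hF.isOpen_biInter fun s _ => isOpen_compl_raySet s)

theorem isOpen_singleton_emptyRay (hT : IsOrderTree T) : IsOpen {emptyRay T} := by
  obtain ⟨r, hr⟩ := hT.1
  have : {emptyRay T} = (raySet r)ᶜ := by
    ext x
    rw [mem_singleton_iff, mem_compl_iff]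
    constructor
    · rintro rfl
      exact notMem_empty r
    · refine fun h => Subtype.ext (eq_empty_of_forall_notMem fun t ht => h ?_)
      exact x.2.1.2 (hr t) ht
  rw [this]
  exact isOpen_compl_raySet r

/-- If a path `x` lies strictly below a node, then `x` has a top below that node. -/
theorem exists_isTopOf_le (hT : IsOrderTree T) {x : Set T} (hx : IsPath x) {s : T}
    (hs : s ∉ x) (hxs : x ⊆ Iio s) : ∃ a ≤ s, IsTopOf a x := by
  obtain ⟨a, ⟨has, hax⟩, hmin⟩ := hT.wellFounded_lt.has_min {a | a ≤ s ∧ a ∉ x} ⟨s, le_rfl, hs⟩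
  refine ⟨a, has, Subset.antisymm (fun u hu => ?_) fun u hu => ?_⟩
  · by_contra hux
    exact hmin u ⟨(le_of_lt hu).trans has, hux⟩ hu
  · have hau : ¬a ≤ u := fun h => hax (hx.2 h hu)
    rcases (hT.2 s).1.total has (le_of_lt (hxs hu)) with h | h
    · exact absurd h hau
    · exact lt_of_le_not_ge h hau

theorem exists_mem_rayBase_subset_compl_raySet (hT : IsOrderTree T) {x : RaySpace T} {s : T}
    (hs : s ∉ x.1) : ∃ V ∈ rayBase T, x ∈ V ∧ V ⊆ (raySet s)ᶜ := by
  rcases x.1.eq_empty_or_nonempty with h | ⟨t, ht⟩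
  · obtain rfl : x = emptyRay T := Subtype.ext h
    exact ⟨_, Or.inl rfl, rfl, by rintro _ rfl; exact hs⟩
  by_cases hxs : x.1 ⊆ Iio s
  · obtain ⟨a, has, ha⟩ := exists_isTopOf_le hT x.2.1 hs hxs
    refine ⟨rayBasicSet t {a}, Or.inr ⟨t, {a}, finite_singleton a, ?_, rfl⟩, ⟨ht, ?_⟩, ?_⟩
    · rintro _ rfl
      rw [show Iio _ = x.1 from ha]
      exact x.2
    · rintro _ rfl
      rw [← show Iio _ = x.1 from ha]
      exact lt_irrefl _
    · exact fun y hy hsy => hy.2 a rfl (y.2.1.2 has hsy)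
  · obtain ⟨u, hu, hus⟩ := not_subset.1 hxs
    refine ⟨rayBasicSet u ∅, Or.inr ⟨u, ∅, finite_empty, by simp, rfl⟩, ⟨hu, by simp⟩, ?_⟩
    intro y hy hsy
    rcases y.2.1.1.total hy.1 hsy with h | h
    · exact hus (lt_of_le_of_ne h fun h => hs (h ▸ hu))
    · exact hs (x.2.1.2 h hu)

theorem exists_mem_rayBase_subset_inter {x : RaySpace T} {U V : Set (RaySpace T)}
    (hU : U ∈ rayBase T) (hV : V ∈ rayBase T) (hxU : x ∈ U) (hxV : x ∈ V) :
    ∃ W ∈ rayBase T, x ∈ W ∧ W ⊆ U ∩ V := by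
  have aux : ∀ {U : Set (RaySpace T)}, x ∈ U → U = {emptyRay T} → U ⊆ {x} := by
    rintro _ h rfl
    rw [mem_singleton_iff.1 h]
  rcases hU with h | ⟨t, F, hF, hFr, rfl⟩
  · exact ⟨U, Or.inl h, hxU, fun y hy => ⟨hy, (aux hxU h hy : y = x) ▸ hxV⟩⟩
  rcases hV with h | ⟨t', F', hF', hFr', rfl⟩
  · exact ⟨V, Or.inl h, hxV, fun y hy => ⟨(aux hxV h hy : y = x) ▸ hxU, hy⟩⟩
  obtain ⟨a, ha, hta, hta'⟩ : ∃ a ∈ x.1, t ≤ a ∧ t' ≤ a := by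
    rcases x.2.1.1.total hxU.1 hxV.1 with h | h
    exacts [⟨t', hxV.1, h, le_rfl⟩, ⟨t, hxU.1, le_rfl, h⟩]
  refine ⟨rayBasicSet a (F ∪ F'), Or.inr ⟨a, _, hF.union hF', ?_, rfl⟩, ⟨ha, ?_⟩, fun y hy => ?_⟩
  · exact fun s hs => hs.elim (hFr s) (hFr' s)
  · exact fun s hs => hs.elim (hxU.2 s) (hxV.2 s)
  · exact ⟨⟨y.2.1.2 hta hy.1, fun s hs => hy.2 s (Or.inl hs)⟩,
      ⟨y.2.1.2 hta' hy.1, fun s hs => hy.2 s (Or.inr hs)⟩⟩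

theorem isBaseFam_rayBase (hT : IsOrderTree T) : IsBaseFam (rayBase T) := by
  have mem_base : ∀ t : T, rayBasicSet t ∅ ∈ rayBase T := fun t =>
    Or.inr ⟨t, ∅, finite_empty, by simp, rfl⟩
  constructor
  · rintro _ (rfl | ⟨t, F, hF, -, rfl⟩)
    exacts [isOpen_singleton_emptyRay hT, isOpen_rayBasicSet t hF]
  · intro U hU
    rw [raySpace_topology_eq] at hU
    induction hU with
    | basic U hU =>
      intro x hx
      obtain ⟨t, rfl | rfl⟩ := hU
      · exact ⟨_, mem_base t, ⟨hx, by simp⟩, fun y hy => hy.1⟩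
      · exact exists_mem_rayBase_subset_compl_raySet hT hx
    | univ =>
      intro x _
      rcases x.1.eq_empty_or_nonempty with h | ⟨t, ht⟩
      · exact ⟨_, Or.inl rfl, Subtype.ext h, subset_univ _⟩
      · exact ⟨_, mem_base t, ⟨ht, by simp⟩, subset_univ _⟩
    | inter U V _ _ ihU ihV =>
      intro x hx
      obtain ⟨U', hU', hxU', hUU'⟩ := ihU x hx.1
      obtain ⟨V', hV', hxV', hVV'⟩ := ihV x hx.2
      obtain ⟨W, hW, hxW, hWsub⟩ := exists_mem_rayBase_subset_inter hU' hV' hxU' hxV'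
      exact ⟨W, hW, hxW, hWsub.trans (inter_subset_inter hUU' hVV')⟩
    | sUnion S _ ih =>
      rintro x ⟨U, hU, hx⟩
      obtain ⟨V, hV, hxV, hVU⟩ := ih U hU x hx
      exact ⟨V, hV, hxV, hVU.trans (subset_sUnion_of_mem hU)⟩

/-- Given a chain `P` of nodes each lying on a ray, and a set `Q` of tops of rays none of
which is below a node of `P`, there is a ray containing `P` and avoiding `Q`. -/
theorem exists_isRay_subset_avoiding (hT : IsOrderTree T) {P Q : Set T}
    (hPchain : IsChain (· ≤ ·) P) (hPray : ∀ t ∈ P, ∃ x, IsRay x ∧ t ∈ x)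
    (hQ : ∀ s ∈ Q, IsRay (Iio s)) (hPQ : ∀ t ∈ P, ∀ s ∈ Q, ¬s ≤ t) :
    ∃ y, IsRay y ∧ P ⊆ y ∧ ∀ s ∈ Q, s ∉ y := by
  by_cases hmax : ∃ m ∈ P, ∀ t ∈ P, t ≤ m
  · obtain ⟨m, hm, hle⟩ := hmax
    by_cases hQm : ∃ s ∈ Q, m < s
    · obtain ⟨s, ⟨hsQ, hms⟩, hmin⟩ := hT.wellFounded_lt.has_min {s | s ∈ Q ∧ m < s} hQm
      refine ⟨Iio s, hQ s hsQ, fun t ht => (hle t ht).trans_lt hms, fun s' hs' hlt => ?_⟩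
      rcases (hT.2 s).1.total (le_of_lt hlt) hms.le with h | h
      · exact hPQ m hm s' hs' h
      · exact hmin s' ⟨hs', lt_of_le_not_ge h (hPQ m hm s' hs')⟩ hlt
    · obtain ⟨x, hx, hmx⟩ := hPray m hm
      refine ⟨x, hx, fun t ht => hx.1.2 (hle t ht) hmx, fun s hs hsx => ?_⟩
      rcases hx.1.1.total hsx hmx with h | h
      · exact hPQ m hm s hs h
      · exact hQm ⟨s, hs, lt_of_le_not_ge h (hPQ m hm s hs)⟩
  · push Not at hmax
    refine ⟨{u | ∃ t ∈ P, u ≤ t}, ⟨⟨?_, ?_⟩, ?_⟩, fun t ht => ⟨t, ht, le_rfl⟩, ?_⟩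
    · rintro u ⟨t, ht, hut⟩ v ⟨t', ht', hvt'⟩ -
      rcases hPchain.total ht ht' with h | h
      · exact (hT.2 t').1.total (hut.trans h) hvt'
      · exact (hT.2 t).1.total hut (hvt'.trans h)
    · rintro u v huv ⟨t, ht, hvt⟩
      exact ⟨t, ht, huv.trans hvt⟩
    · rintro u ⟨t, ht, hut⟩
      obtain ⟨t', ht', hnle⟩ := hmax t ht
      have htt' : t ≤ t' := (hPchain.total ht ht').resolve_right hnle
      exact ⟨t', ⟨t', ht', le_rfl⟩, hut.trans_lt (lt_of_le_not_ge htt' hnle)⟩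
    · rintro s hs ⟨t, ht, hst⟩
      exact hPQ t ht s hs hst

theorem completeFam_rayBase (hT : IsOrderTree T) : CompleteFam (rayBase T) := by
  intro 𝒞 h𝒞 hcen
  by_cases hempty : {emptyRay T} ∈ 𝒞
  · refine ⟨emptyRay T, fun V hV => ?_⟩
    obtain ⟨x, hx, rfl⟩ := hcen.inter_nonempty hV hempty
    exact hx
  have hbasic : ∀ V ∈ 𝒞, ∃ (t : T) (F : Set T),
      (∀ s ∈ F, IsRay (Iio s)) ∧ V = rayBasicSet t F := by
    intro V hV
    rcases h𝒞 hV with rfl | ⟨t, F, -, hF, rfl⟩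
    exacts [absurd hV hempty, ⟨t, F, hF, rfl⟩]
  have : Nonempty T := ⟨hT.1.choose⟩
  choose! t F hF hV using hbasic
  have hinter : ∀ U ∈ 𝒞, ∀ V ∈ 𝒞, ∃ x, IsRay x ∧ t U ∈ x ∧ t V ∈ x ∧ ∀ s ∈ F V, s ∉ x := by
    intro U hU V hV'
    obtain ⟨x, hxU, hxV⟩ := hcen.inter_nonempty hU hV'
    rw [hV U hU] at hxU
    rw [hV V hV'] at hxV
    exact ⟨x.1, x.2, hxU.1, hxV.1, hxV.2⟩
  obtain ⟨y, hy, hPy, hQy⟩ := exists_isRay_subset_avoiding hT (P := t '' 𝒞)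
    (Q := {s | ∃ V ∈ 𝒞, s ∈ F V})
    (by
      rintro _ ⟨U, hU, rfl⟩ _ ⟨V, hV', rfl⟩ -
      obtain ⟨x, hx, htU, htV, -⟩ := hinter U hU V hV'
      exact hx.1.1.total htU htV)
    (by
      rintro _ ⟨U, hU, rfl⟩
      obtain ⟨x, hx, htU, -⟩ := hinter U hU U hU
      exact ⟨x, hx, htU⟩)
    (by
      rintro s ⟨V, hV', hs⟩
      exact hF V hV' s hs)
    (by
      rintro _ ⟨U, hU, rfl⟩ s ⟨V, hV', hs⟩ hle
      obtain ⟨x, hx, htU, -, hFx⟩ := hinter U hU V hV'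
      exact hFx s hs (hx.1.2 hle htU))
  refine ⟨⟨y, hy⟩, fun V hV' => ?_⟩
  rw [hV V hV']
  exact ⟨hPy ⟨V, hV', rfl⟩, fun s hs => hQy s ⟨V, hV', hs⟩⟩

end OrderTree

/-- Every ray space `R(T)` is base-complete: it admits a base of open sets
such that every centered subfamily of the base has nonempty intersection; consequently,
every ray space is a Baire space. -/
theorem stmt3 {T : Type u} [PartialOrder T] (hT : IsOrderTree T) :
    (∃ B : Set (Set (RaySpace T)), IsBaseFam B ∧ CompleteFam B) ∧
    BaireSpace (RaySpace T) := by
  have hbase := isBaseFam_rayBase hT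
  have hcomplete := completeFam_rayBase hT
  exact ⟨⟨rayBase T, hbase, hcomplete⟩, .of_completeFam hbase hcomplete⟩
end

section
/- For every order tree T, the collection S = {[t] : t ∈ T} of subsets of the ray space R(T) is hereditarily complete: for every closed subspace Y ⊆ R(T), every subfamily of {[t] ∩ Y : t ∈ T} that is centered has nonempty intersection. -/
open Set Topology

universe u v

/-- In an order tree, the down-closure of a chain is a path. -/
theorem IsOrderTree.isPath_lowerClosure {T : Type u} [PartialOrder T] (hT : IsOrderTree T)
    {D : Set T} (hD : IsChain (· ≤ ·) D) : IsPath (lowerClosure D : Set T) := by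
  refine ⟨?_, fun s t hst ht => (lowerClosure D).lower hst ht⟩
  rintro a ⟨t, ht, hat⟩ b ⟨t', ht', hbt'⟩ hab
  rcases hD.total ht ht' with h | h
  · exact (hT.2 t').1 (hat.trans h) hbt' hab
  · exact (hT.2 t).1 hat (le_trans hbt' h) hab

/-- A family of rays converges to `x` if it does so coordinatewise. -/
theorem RaySpace.tendsto_nhds {T : Type u} [PartialOrder T] {ι : Type v} {l : Filter ι}
    {f : ι → RaySpace T} {x : RaySpace T} (hmem : ∀ s ∈ x.1, ∀ᶠ i in l, s ∈ (f i).1)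
    (hnot : ∀ s ∉ x.1, ∀ᶠ i in l, s ∉ (f i).1) : Filter.Tendsto f l (𝓝 x) := by
  let _ : TopologicalSpace (Set T) := cylinderTopology T
  rw [nhds_induced, Filter.tendsto_comap_iff]
  refine TopologicalSpace.tendsto_nhds_generateFrom_iff.2 ?_
  rintro C ⟨s, rfl | rfl⟩ hx
  · exact hmem s hx
  · exact hnot s hx

/-- If every node of a chain `D` lies on a ray of the closed set `Y`, then some ray of `Y`
contains all of `D`. -/
theorem IsOrderTree.exists_ray_of_isChain {T : Type u} [PartialOrder T] (hT : IsOrderTree T)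
    {Y : Set (RaySpace T)} (hY : IsClosed Y) {D : Set T} (hne : D.Nonempty)
    (hD : IsChain (· ≤ ·) D) (hDY : ∀ t ∈ D, ∃ y ∈ Y, t ∈ y.1) :
    ∃ y ∈ Y, ∀ t ∈ D, t ∈ y.1 := by
  by_cases hub : ∃ y ∈ Y, ∃ s ∈ y.1, ∀ t ∈ D, t ≤ s
  · obtain ⟨y, hy, s, hs, hDs⟩ := hub
    exact ⟨y, hy, fun t ht => y.2.1.2 (hDs t ht) hs⟩
  have hbdd : ∀ y ∈ Y, ∀ s ∈ y.1, ∃ t ∈ D, ¬ t ≤ s := by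
    intro y hy s hs
    by_contra! h
    exact hub ⟨y, hy, s, hs, h⟩
  have hray : IsRay (lowerClosure D : Set T) := by
    refine ⟨hT.isPath_lowerClosure hD, ?_⟩
    rintro s ⟨t, ht, hst⟩
    obtain ⟨y, hy, hty⟩ := hDY t ht
    obtain ⟨t', ht', hn⟩ := hbdd y hy t hty
    refine ⟨t', subset_lowerClosure ht', hst.trans_lt ?_⟩
    exact lt_of_le_not_ge ((hD.total ht ht').resolve_right hn) hn
  choose y hyY hy using fun t : D => hDY t t.2
  have : Nonempty D := hne.to_subtype
  have : IsDirectedOrder D := ⟨fun a b => (hD.total a.2 b.2).elim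
    (fun h => ⟨b, h, le_rfl⟩) (fun h => ⟨a, le_rfl, h⟩)⟩
  have hlim : Filter.Tendsto y Filter.atTop (𝓝 (⟨lowerClosure D, hray⟩ : RaySpace T)) := by
    refine RaySpace.tendsto_nhds ?_ ?_
    · rintro s ⟨t, ht, hst⟩
      filter_upwards [Filter.eventually_ge_atTop (⟨t, ht⟩ : D)] with i hi
      exact (y i).2.1.2 (hst.trans hi) (hy i)
    · intro s hs
      by_cases h : ∃ i, s ∈ (y i).1
      · obtain ⟨i, hi⟩ := h
        obtain ⟨t, ht, hts⟩ := hbdd (y i) (hyY i) s hi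
        filter_upwards [Filter.eventually_ge_atTop (⟨t, ht⟩ : D)] with j hj hsj
        rcases (y j).2.1.1.total hsj (hy j) with h | h
        · exact hs ⟨j, j.2, h⟩
        · exact hts (le_trans hj h)
      · exact Filter.Eventually.of_forall fun i hi => h ⟨i, hi⟩
  exact ⟨_, hY.mem_of_tendsto hlim (Filter.Eventually.of_forall hyY),
    fun t ht => subset_lowerClosure ht⟩

/-- For every order tree `T`, the collection `{[t] : t ∈ T}` of subsets of
the ray space `R(T)` is hereditarily complete. -/
theorem stmt4 {T : Type u} [PartialOrder T] (hT : IsOrderTree T) :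
    HeredCompleteFam {A : Set (RaySpace T) | ∃ t : T, A = raySet t} := by
  intro Y hY 𝒞 h𝒞 hcent
  rcases 𝒞.eq_empty_or_nonempty with rfl | ⟨B, hB⟩
  · simpa using hcent ∅ (by simp)
  have hchain : IsChain (· ≤ ·) {t : T | raySet t ∩ Y ∈ 𝒞} := by
    classical
    intro s hs t ht hst
    obtain ⟨y, hy⟩ := hcent {raySet s ∩ Y, raySet t ∩ Y} (by
      simpa [Set.insert_subset_iff] using And.intro hs ht)
    have hys : y ∈ raySet s ∩ Y := hy _ (by simp)
    have hyt : y ∈ raySet t ∩ Y := hy _ (by simp)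
    exact y.2.1.1 hys.1 hyt.1 hst
  have hne : {t : T | raySet t ∩ Y ∈ 𝒞}.Nonempty := by
    obtain ⟨_, ⟨t, rfl⟩, rfl⟩ := h𝒞 hB
    exact ⟨t, hB⟩
  obtain ⟨y, hyY, hy⟩ := hT.exists_ray_of_isChain hY hne hchain fun t ht => by
    obtain ⟨y, hy⟩ := hcent {raySet t ∩ Y} (by simpa using ht)
    have hyt : y ∈ raySet t ∩ Y := hy _ (by simp)
    exact ⟨y, hyt.2, hyt.1⟩
  refine ⟨y, fun C hC => ?_⟩
  obtain ⟨_, ⟨t, rfl⟩, rfl⟩ := h𝒞 hC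
  exact ⟨hy t hC, hyY⟩
end

section
/- For every order tree T, the ray space R(T) is monotonically normal: to each pair (U, x) with U open in R(T) and x ∈ U one can assign an open set U_x with x ∈ U_x ⊆ U such that whenever U_x ∩ V_y ≠ ∅ for two such pairs (U,x) and (V,y), we have x ∈ V or y ∈ U. In particular, every ray space is hereditarily normal (T5). -/
open Set Topology

universe u v

/-- The cylinder at a node is open in the ray space. -/
theorem isOpen_raySet_s5 {T : Type u} [PartialOrder T] (t : T) :
    IsOpen (raySet t : Set (RaySpace T)) :=
  (@isOpen_induced_iff _ _ (cylinderTopology T) _ _).2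
    ⟨{s | t ∈ s}, TopologicalSpace.isOpen_generateFrom_of_mem ⟨t, Or.inl rfl⟩, rfl⟩

/-- The cylinder at a node is closed in the ray space. -/
theorem isClosed_raySet {T : Type u} [PartialOrder T] (t : T) :
    IsClosed (raySet t : Set (RaySpace T)) :=
  ⟨(@isOpen_induced_iff _ _ (cylinderTopology T) _ _).2
    ⟨{s | t ∉ s}, TopologicalSpace.isOpen_generateFrom_of_mem ⟨t, Or.inr rfl⟩, rfl⟩⟩

theorem IsPath.le_or_le {T : Type u} [PartialOrder T] {x : Set T} (hx : IsPath x) {s t : T}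
    (hs : s ∈ x) (ht : t ∈ x) : s ≤ t ∨ t ≤ s :=
  hx.1.total hs ht

/-- In an order tree, every node above a path but outside it lies above a top of the path. -/
theorem IsOrderTree.exists_le_isTopOf {T : Type u} [PartialOrder T] (hT : IsOrderTree T)
    {x : Set T} (hx : IsPath x) {s : T} (hs : s ∉ x) (hxs : ∀ u ∈ x, u ≤ s) :
    ∃ m ≤ s, IsTopOf m x := by
  obtain ⟨hchain, hwf⟩ := hT.2 s
  have hwf' : (Iic s \ x).IsWF := hwf.mono sdiff_subset
  have hne : (Iic s \ x).Nonempty := ⟨s, le_rfl, hs⟩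
  obtain ⟨hms, hmx⟩ := hwf'.min_mem hne
  refine ⟨hwf'.min hne, hms, Subset.antisymm (fun u hu => ?_) (fun u hu => ?_)⟩
  · by_contra hux
    exact hwf'.not_lt_min hne ⟨hu.le.trans hms, hux⟩ hu
  · have hmu : ¬ hwf'.min hne ≤ u := fun h => hmx (hx.2 h hu)
    exact lt_of_le_not_ge ((hchain.total (hxs u hu) hms).resolve_right hmu) hmu

/-- The set of rays through `t` avoiding every node of `F`. -/
def rayNhd {T : Type u} [PartialOrder T] (t : T) (F : Set T) : Set (RaySpace T) :=
  raySet t \ ⋃ s ∈ F, raySet s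

theorem mem_rayNhd {T : Type u} [PartialOrder T] {t : T} {F : Set T} {z : RaySpace T} :
    z ∈ rayNhd t F ↔ t ∈ z.1 ∧ ∀ s ∈ F, s ∉ z.1 := by
  simp [rayNhd, raySet]

theorem isOpen_rayNhd {T : Type u} [PartialOrder T] (t : T) {F : Set T} (hF : F.Finite) :
    IsOpen (rayNhd t F) :=
  (isOpen_raySet_s5 t).sdiff (hF.isClosed_biUnion fun s _ => isClosed_raySet s)

theorem IsTopOf.notMem {T : Type u} [PartialOrder T] {t : T} {x : Set T} (h : IsTopOf t x) :
    t ∉ x :=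
  fun ht => lt_irrefl t (show t ∈ Iio t from h.symm ▸ ht)

/-- A nonempty ray has a neighbourhood base of sets `rayNhd t F` with `t` on the ray and `F` a
finite set of tops of the ray. -/
theorem IsOrderTree.exists_rayNhd_subset {T : Type u} [PartialOrder T] (hT : IsOrderTree T)
    {U : Set (RaySpace T)} (hU : IsOpen U) {x : RaySpace T} (hxU : x ∈ U)
    (hne : x.1.Nonempty) :
    ∃ t ∈ x.1, ∃ F : Set T, F.Finite ∧ (∀ s ∈ F, IsTopOf s x.1) ∧ rayNhd t F ⊆ U := by
  obtain ⟨W, hW, rfl⟩ := (@isOpen_induced_iff _ _ (cylinderTopology T) _ _).1 hU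
  clear hU
  change TopologicalSpace.GenerateOpen _ W at hW
  induction hW with
  | basic C hC =>
    obtain ⟨s, rfl | rfl⟩ := hC
    · exact ⟨s, hxU, ∅, finite_empty, by simp, fun z hz => (mem_rayNhd.1 hz).1⟩
    · by_cases hxs : ∀ u ∈ x.1, u ≤ s
      · obtain ⟨m, hms, hm⟩ := hT.exists_le_isTopOf x.2.1 hxU hxs
        obtain ⟨t, ht⟩ := hne
        refine ⟨t, ht, {m}, finite_singleton m, by simpa using hm, fun z hz hsz => ?_⟩
        exact (mem_rayNhd.1 hz).2 m rfl (z.2.1.2 hms hsz)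
      · push Not at hxs
        obtain ⟨t, ht, hts⟩ := hxs
        refine ⟨t, ht, ∅, finite_empty, by simp, fun z hz hsz => ?_⟩
        rcases z.2.1.le_or_le (mem_rayNhd.1 hz).1 hsz with h | h
        · exact hts h
        · exact hxU (x.2.1.2 h ht)
  | univ =>
    obtain ⟨t, ht⟩ := hne
    exact ⟨t, ht, ∅, finite_empty, by simp, fun z _ => trivial⟩
  | inter A B _ _ ihA ihB =>
    obtain ⟨t, ht, F, hF, hFx, hA⟩ := ihA hxU.1
    obtain ⟨t', ht', F', hF', hFx', hB⟩ := ihB hxU.2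
    have key : ∃ m ∈ x.1, t ≤ m ∧ t' ≤ m := by
      rcases x.2.1.le_or_le ht ht' with h | h
      · exact ⟨t', ht', h, le_rfl⟩
      · exact ⟨t, ht, le_rfl, h⟩
    obtain ⟨m, hm, htm, htm'⟩ := key
    refine ⟨m, hm, F ∪ F', hF.union hF', fun s hs => hs.elim (hFx s) (hFx' s), fun z hz => ?_⟩
    obtain ⟨hmz, hz⟩ := mem_rayNhd.1 hz
    exact ⟨hA (mem_rayNhd.2 ⟨z.2.1.2 htm hmz, fun s hs => hz s (Or.inl hs)⟩),
      hB (mem_rayNhd.2 ⟨z.2.1.2 htm' hmz, fun s hs => hz s (Or.inr hs)⟩)⟩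
  | sUnion S _ ih =>
    obtain ⟨A, hAS, hxA⟩ := hxU
    obtain ⟨t, ht, F, hF, hFx, hA⟩ := ih A hAS hxA
    exact ⟨t, ht, F, hF, hFx, fun z hz => ⟨A, hAS, hA hz⟩⟩

/-- If two basic neighbourhoods of rays `x` and `y` meet, then one of them contains both rays. -/
theorem mem_or_mem_of_rayNhd_inter_nonempty {T : Type u} [PartialOrder T] {x y : RaySpace T}
    {t t' : T} {F F' : Set T} (ht : t ∈ x.1) (ht' : t' ∈ y.1)
    (hF : ∀ s ∈ F, IsTopOf s x.1) (hF' : ∀ s ∈ F', IsTopOf s y.1)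
    (h : (rayNhd t F ∩ rayNhd t' F').Nonempty) :
    x ∈ rayNhd t' F' ∨ y ∈ rayNhd t F := by
  wlog htt : t ≤ t' generalizing x y t t' F F' with hsymm
  · obtain ⟨z, hz, hz'⟩ := h
    have hle := (z.2.1.le_or_le (mem_rayNhd.1 hz).1 (mem_rayNhd.1 hz').1).resolve_left htt
    exact (hsymm ht' ht hF' hF ⟨z, hz', hz⟩ hle).symm
  obtain ⟨z, hz, hz'⟩ := h
  obtain ⟨-, hzF⟩ := mem_rayNhd.1 hz
  obtain ⟨hzt', -⟩ := mem_rayNhd.1 hz'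
  refine or_iff_not_imp_right.2 fun hy => ?_
  have hs : ∃ s ∈ F, s ∈ y.1 := by
    by_contra! hcon
    exact hy (mem_rayNhd.2 ⟨y.2.1.2 htt ht', hcon⟩)
  obtain ⟨s, hsF, hsy⟩ := hs
  have hst : ¬ s ≤ t' := fun h => hzF s hsF (z.2.1.2 h hzt')
  have hlt : t' < s := lt_of_le_not_ge ((y.2.1.le_or_le hsy ht').resolve_left hst) hst
  have hx : Iio s = x.1 := hF s hsF
  refine mem_rayNhd.2 ⟨hx ▸ hlt, fun s' hs' hs'x => (hF' s' hs').notMem ?_⟩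
  rw [← hx] at hs'x
  exact y.2.1.2 hs'x.le hsy

/-- The empty ray is an isolated point. -/
theorem IsOrderTree.isOpen_singleton_of_eq_empty {T : Type u} [PartialOrder T]
    (hT : IsOrderTree T) {x : RaySpace T} (hx : x.1 = ∅) : IsOpen {x} := by
  obtain ⟨r, hr⟩ := hT.1
  convert (isClosed_raySet r).isOpen_compl using 1
  ext z
  refine ⟨?_, fun hz => Subtype.ext ?_⟩
  · rintro rfl hz
    exact (hx ▸ hz : r ∈ (∅ : Set T))
  · rw [hx]
    exact eq_empty_of_forall_notMem fun t ht => hz (z.2.1.2 (hr t) ht)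

/-- The monotone normality operator of the ray space. -/
theorem IsOrderTree.exists_monotoneNormality_operator {T : Type u} [PartialOrder T]
    (hT : IsOrderTree T) :
    ∃ μ : Set (RaySpace T) → RaySpace T → Set (RaySpace T),
      (∀ (U : Set (RaySpace T)) (x : RaySpace T), IsOpen U → x ∈ U →
        IsOpen (μ U x) ∧ x ∈ μ U x ∧ μ U x ⊆ U) ∧
      ∀ (U : Set (RaySpace T)) (x : RaySpace T) (V : Set (RaySpace T)) (y : RaySpace T),
        IsOpen U → x ∈ U → IsOpen V → y ∈ V →
          (μ U x ∩ μ V y).Nonempty → x ∈ V ∨ y ∈ U := by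
  have base : ∀ (U : Set (RaySpace T)) (x : RaySpace T), ∃ B : Set (RaySpace T),
      IsOpen U → x ∈ U → B ⊆ U ∧ (x.1 = ∅ ∧ B = {x} ∨ ∃ t ∈ x.1, ∃ F : Set T,
        F.Finite ∧ (∀ s ∈ F, IsTopOf s x.1) ∧ B = rayNhd t F) := by
    intro U x
    by_cases h : IsOpen U ∧ x ∈ U
    · rcases x.1.eq_empty_or_nonempty with hx | hx
      · exact ⟨{x}, fun _ _ => ⟨singleton_subset_iff.2 h.2, Or.inl ⟨hx, rfl⟩⟩⟩
      · obtain ⟨t, ht, F, hF, hFx, hsub⟩ := hT.exists_rayNhd_subset h.1 h.2 hx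
        exact ⟨rayNhd t F, fun _ _ => ⟨hsub, Or.inr ⟨t, ht, F, hF, hFx, rfl⟩⟩⟩
    · exact ⟨∅, fun hU hx => (h ⟨hU, hx⟩).elim⟩
  choose μ hμ using base
  refine ⟨μ, fun U x hU hx => ?_, fun U x V y hU hx hV hy hne => ?_⟩
  · obtain ⟨hsub, ⟨hx0, hB⟩ | ⟨t, ht, F, hF, hFx, hB⟩⟩ := hμ U x hU hx
    · refine ⟨hB ▸ hT.isOpen_singleton_of_eq_empty hx0, ?_, hsub⟩
      rw [hB]
      rfl
    · refine ⟨hB ▸ isOpen_rayNhd t hF, ?_, hsub⟩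
      rw [hB]
      exact mem_rayNhd.2 ⟨ht, fun s hs => (hFx s hs).notMem⟩
  · obtain ⟨hsubU, ⟨-, hB⟩ | ⟨t, ht, F, -, hFx, hB⟩⟩ := hμ U x hU hx
    · obtain ⟨z, hz, hz'⟩ := hne
      rw [hB] at hz
      obtain rfl : z = x := hz
      exact Or.inl ((hμ V y hV hy).1 hz')
    obtain ⟨hsubV, ⟨-, hB'⟩ | ⟨t', ht', F', -, hFy, hB'⟩⟩ := hμ V y hV hy
    · obtain ⟨z, hz, hz'⟩ := hne
      rw [hB'] at hz'
      obtain rfl : z = y := hz'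
      exact Or.inr (hsubU hz)
    rw [hB] at hne hsubU
    rw [hB'] at hne hsubV
    exact (mem_or_mem_of_rayNhd_inter_nonempty ht ht' hFx hFy hne).imp (@hsubV x) (@hsubU y)

/-- A space with a monotone normality operator is completely normal. -/
theorem completelyNormalSpace_of_monotoneNormality {X : Type v} [TopologicalSpace X]
    (μ : Set X → X → Set X)
    (hμ : ∀ (U : Set X) (x : X), IsOpen U → x ∈ U → IsOpen (μ U x) ∧ x ∈ μ U x ∧ μ U x ⊆ U)
    (hμ' : ∀ (U : Set X) (x : X) (V : Set X) (y : X), IsOpen U → x ∈ U → IsOpen V → y ∈ V →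
      (μ U x ∩ μ V y).Nonempty → x ∈ V ∨ y ∈ U) :
    CompletelyNormalSpace X where
  completely_normal s t hst hst' := by
    have hs : ∀ x ∈ s, x ∈ (closure t)ᶜ := fun x hx => disjoint_left.1 hst' hx
    have ht : ∀ y ∈ t, y ∈ (closure s)ᶜ := fun y hy => disjoint_right.1 hst hy
    have hos : IsOpen (closure s)ᶜ := isClosed_closure.isOpen_compl
    have hot : IsOpen (closure t)ᶜ := isClosed_closure.isOpen_compl
    refine separatedNhds_iff_disjoint.1 ⟨⋃ x ∈ s, μ (closure t)ᶜ x, ⋃ y ∈ t, μ (closure s)ᶜ y,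
      isOpen_biUnion fun x hx => (hμ _ x hot (hs x hx)).1,
      isOpen_biUnion fun y hy => (hμ _ y hos (ht y hy)).1,
      fun x hx => mem_biUnion hx (hμ _ x hot (hs x hx)).2.1,
      fun y hy => mem_biUnion hy (hμ _ y hos (ht y hy)).2.1, ?_⟩
    refine disjoint_left.2 fun z hz hz' => ?_
    obtain ⟨x, hx, hzx⟩ := mem_iUnion₂.1 hz
    obtain ⟨y, hy, hzy⟩ := mem_iUnion₂.1 hz'
    rcases hμ' _ x _ y hot (hs x hx) hos (ht y hy) ⟨z, hzx, hzy⟩ with h | h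
    · exact h (subset_closure hx)
    · exact h (subset_closure hy)

theorem t1Space_raySpace (T : Type u) [PartialOrder T] : T1Space (RaySpace T) := by
  refine t1Space_iff_exists_open.2 fun x y hxy => ?_
  by_cases h : x.1 ⊆ y.1
  · obtain ⟨t, hty, htx⟩ : ∃ t ∈ y.1, t ∉ x.1 := not_subset.1 fun h' =>
      hxy (Subtype.ext (Subset.antisymm h h'))
    exact ⟨(raySet t)ᶜ, (isClosed_raySet t).isOpen_compl, htx, fun hy => hy hty⟩
  · obtain ⟨t, htx, hty⟩ := not_subset.1 h
    exact ⟨raySet t, isOpen_raySet_s5 t, htx, hty⟩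

/-- Every ray space `R(T)` is monotonically normal; in particular it is
hereditarily normal (T5). -/
theorem stmt5 {T : Type u} [PartialOrder T] (hT : IsOrderTree T) :
    (∃ μ : Set (RaySpace T) → RaySpace T → Set (RaySpace T),
      (∀ (U : Set (RaySpace T)) (x : RaySpace T), IsOpen U → x ∈ U →
        IsOpen (μ U x) ∧ x ∈ μ U x ∧ μ U x ⊆ U) ∧
      ∀ (U : Set (RaySpace T)) (x : RaySpace T) (V : Set (RaySpace T)) (y : RaySpace T),
        IsOpen U → x ∈ U → IsOpen V → y ∈ V →
          (μ U x ∩ μ V y).Nonempty → x ∈ V ∨ y ∈ U) ∧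
    T5Space (RaySpace T) := by
  obtain ⟨μ, hμ, hμ'⟩ := hT.exists_monotoneNormality_operator
  have := t1Space_raySpace T
  have := completelyNormalSpace_of_monotoneNormality μ hμ hμ'
  exact ⟨⟨μ, hμ, hμ'⟩, {}⟩
end

section
/- For every order tree T, the ray space R(T) is ultraparacompact: every open cover of R(T) can be refined to a cover of R(T) by pairwise disjoint open sets (an open partition of R(T)). -/
open Set Topology

universe u v

/-- `A` has a partition into open sets, each contained in a member of `𝒰`. -/
def HasOpenPartition {X : Type v} [TopologicalSpace X] (𝒰 : Set (Set X)) (A : Set X) : Prop :=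
  ∃ 𝒱 : Set (Set X), (∀ V ∈ 𝒱, IsOpen V) ∧ ⋃₀ 𝒱 = A ∧ 𝒱.Pairwise Disjoint ∧
    ∀ V ∈ 𝒱, ∃ U ∈ 𝒰, V ⊆ U

namespace HasOpenPartition

variable {X : Type v} [TopologicalSpace X] {𝒰 : Set (Set X)} {A B : Set X}

theorem empty : HasOpenPartition 𝒰 ∅ :=
  ⟨∅, by simp, by simp, by simp, by simp⟩

theorem of_subset {U : Set X} (hA : IsOpen A) (hU : U ∈ 𝒰) (h : A ⊆ U) :
    HasOpenPartition 𝒰 A :=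
  ⟨{A}, by simpa, by simp, by simp, by simpa using ⟨U, hU, h⟩⟩

theorem mono (hA : HasOpenPartition 𝒰 A) (hB : IsOpen B) (h : B ⊆ A) :
    HasOpenPartition 𝒰 B := by
  obtain ⟨𝒱, ho, hc, hd, hr⟩ := hA
  refine ⟨(· ∩ B) '' 𝒱, ?_, ?_, ?_, ?_⟩
  · rintro _ ⟨V, hV, rfl⟩
    exact (ho V hV).inter hB
  · rw [sUnion_image, ← iUnion₂_inter, ← sUnion_eq_biUnion, hc]
    exact inter_eq_right.2 h
  · rintro _ ⟨V, hV, rfl⟩ _ ⟨W, hW, rfl⟩ hne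
    have hVW : V ≠ W := by
      rintro rfl
      exact hne rfl
    exact (hd hV hW hVW).mono inter_subset_left inter_subset_left
  · rintro _ ⟨V, hV, rfl⟩
    obtain ⟨U, hU, hVU⟩ := hr V hV
    exact ⟨U, hU, inter_subset_left.trans hVU⟩

theorem iUnion {ι : Type*} {A : ι → Set X} (hA : ∀ i, HasOpenPartition 𝒰 (A i))
    (hdisj : Pairwise fun i j => Disjoint (A i) (A j)) :
    HasOpenPartition 𝒰 (⋃ i, A i) := by
  choose 𝒱 ho hc hd hr using hA
  refine ⟨⋃ i, 𝒱 i, ?_, ?_, ?_, ?_⟩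
  · intro V hV
    obtain ⟨i, hi⟩ := mem_iUnion.1 hV
    exact ho i V hi
  · rw [sUnion_iUnion]
    exact iUnion_congr hc
  · intro V hV W hW hne
    obtain ⟨i, hi⟩ := mem_iUnion.1 hV
    obtain ⟨j, hj⟩ := mem_iUnion.1 hW
    by_cases hij : i = j
    · subst hij
      exact hd i hi hj hne
    · refine (hdisj hij).mono ?_ ?_
      · rw [← hc i]
        exact subset_sUnion_of_mem hi
      · rw [← hc j]
        exact subset_sUnion_of_mem hj
  · intro V hV
    obtain ⟨i, hi⟩ := mem_iUnion.1 hV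
    exact hr i V hi

theorem union (hA : HasOpenPartition 𝒰 A) (hA' : IsClosed A) (hB : HasOpenPartition 𝒰 B)
    (hB' : IsOpen B) : HasOpenPartition 𝒰 (A ∪ B) := by
  have hBA : HasOpenPartition 𝒰 (B \ A) := hB.mono (hB'.sdiff hA') sdiff_subset
  have h : A ∪ B = ⋃ b : Bool, cond b A (B \ A) := by
    rw [← union_eq_iUnion, union_sdiff_self]
  rw [h]
  refine iUnion (by rintro (_ | _) <;> assumption) ?_
  rintro (_ | _) (_ | _) hne
  · exact absurd rfl hne
  · exact disjoint_sdiff_left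
  · exact disjoint_sdiff_right
  · exact absurd rfl hne

end HasOpenPartition

namespace RaySpace

variable {T : Type u} [PartialOrder T]

theorem topology_eq_generateFrom :
    RaySpace.topologicalSpace T = TopologicalSpace.generateFrom
      {C : Set (RaySpace T) | ∃ t : T, C = raySet t ∨ C = (raySet t)ᶜ} := by
  unfold RaySpace.topologicalSpace cylinderTopology
  rw [induced_generateFrom_eq]
  congr 1
  ext C
  constructor
  · rintro ⟨_, ⟨t, rfl | rfl⟩, rfl⟩
    · exact ⟨t, Or.inl rfl⟩
    · exact ⟨t, Or.inr rfl⟩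
  · rintro ⟨t, rfl | rfl⟩
    · exact ⟨_, ⟨t, Or.inl rfl⟩, rfl⟩
    · exact ⟨_, ⟨t, Or.inr rfl⟩, rfl⟩

theorem isClopen_raySet (t : T) : IsClopen (raySet t) := by
  rw [IsClopen, ← isOpen_compl_iff, topology_eq_generateFrom]
  exact ⟨.basic _ ⟨t, Or.inr rfl⟩, .basic _ ⟨t, Or.inl rfl⟩⟩

theorem raySet_anti {s t : T} (h : s ≤ t) : raySet t ⊆ raySet s :=
  fun x hx => x.2.1.2 h hx

theorem raySet_eq_iUnion_successors (hT : IsOrderTree T) (t : T) :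
    raySet t = ⋃ s : {s : T // IsSuccessorOf s t}, raySet s.1 := by
  apply Subset.antisymm
  · intro x hx
    obtain ⟨w, hw, htw⟩ := x.2.2 t hx
    obtain ⟨s, hs⟩ := ((hT.2 w).2.mono inter_subset_right :
      (Ioi t ∩ Iic w).IsWF).exists_minimal ⟨w, htw, le_rfl⟩
    refine mem_iUnion.2 ⟨⟨s, hs.1.1, fun u htu hus => ?_⟩, x.2.1.2 hs.1.2 hw⟩
    exact hus.not_ge (hs.2 ⟨htu, hus.le.trans hs.1.2⟩ hus.le)
  · exact iUnion_subset fun s => raySet_anti s.2.1.le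

theorem disjoint_raySet_successors (t : T) :
    Pairwise fun s s' : {s : T // IsSuccessorOf s t} => Disjoint (raySet s.1) (raySet s'.1) := by
  intro s s' hne
  rw [Set.disjoint_left]
  intro x hx hx'
  have hne' : s.1 ≠ s'.1 := fun h => hne (Subtype.ext h)
  rcases x.2.1.1 hx hx' hne' with h | h
  · exact s'.2.2 s.1 s.2.1 (h.lt_of_ne hne')
  · exact s.2.2 s'.1 s'.2.1 (h.lt_of_ne hne'.symm)

/-- If all nodes above a nonempty ray `x` have partitioned cones, then any open neighbourhood of `x`
contains some cone around `x` up to a partitioned clopen set. -/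
theorem exists_raySet_subset_union {𝒰 : Set (Set (RaySpace T))} (x : RaySpace T)
    (hne : x.1.Nonempty)
    (hx : ∀ s ∉ x.1, (∀ t ∈ x.1, t ≤ s) → HasOpenPartition 𝒰 (raySet s))
    {U : Set (RaySpace T)} (hU : IsOpen U) (hxU : x ∈ U) :
    ∃ t ∈ x.1, ∃ G, IsClopen G ∧ HasOpenPartition 𝒰 G ∧ raySet t ⊆ G ∪ U := by
  rw [topology_eq_generateFrom] at hU
  induction hU with
  | basic V hV =>
    obtain ⟨s, rfl | rfl⟩ := hV
    · exact ⟨s, hxU, ∅, isClopen_empty, .empty, by simp⟩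
    · by_cases h : ∀ t ∈ x.1, t ≤ s
      · obtain ⟨t, ht⟩ := hne
        exact ⟨t, ht, raySet s, isClopen_raySet s, hx s hxU h, by simp⟩
      · push Not at h
        obtain ⟨t, ht, hts⟩ := h
        refine ⟨t, ht, ∅, isClopen_empty, .empty, fun y hy => Or.inr fun hys => ?_⟩
        have hst : s ≤ t := (y.2.1.1.total hy hys).resolve_left hts
        exact hxU (x.2.1.2 hst ht)
  | univ =>
    obtain ⟨t, ht⟩ := hne
    exact ⟨t, ht, ∅, isClopen_empty, .empty, by simp⟩
  | inter V W _ _ ihV ihW =>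
    obtain ⟨t, ht, G, hGc, hG, htG⟩ := ihV hxU.1
    obtain ⟨s, hs, H, hHc, hH, hsH⟩ := ihW hxU.2
    have key : ∀ w ∈ x.1, t ≤ w → s ≤ w → ∃ t ∈ x.1, ∃ G, IsClopen G ∧
        HasOpenPartition 𝒰 G ∧ raySet t ⊆ G ∪ V ∩ W := by
      intro w hw htw hsw
      refine ⟨w, hw, G ∪ H, hGc.union hHc, hG.union hGc.1 hH hHc.2, fun y hy => ?_⟩
      have h₁ := htG (raySet_anti htw hy)
      have h₂ := hsH (raySet_anti hsw hy)
      simp only [mem_union, mem_inter_iff] at h₁ h₂ ⊢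
      tauto
    rcases x.2.1.1.total ht hs with h | h
    · exact key s hs h le_rfl
    · exact key t ht le_rfl h
  | sUnion S _ ih =>
    obtain ⟨V, hVS, hxV⟩ := hxU
    obtain ⟨t, ht, G, hGc, hG, htG⟩ := ih V hVS hxV
    exact ⟨t, ht, G, hGc, hG, htG.trans (union_subset_union_right _ (subset_sUnion_of_mem hVS))⟩

theorem hasOpenPartition_raySet (hT : IsOrderTree T) {𝒰 : Set (Set (RaySpace T))}
    (ho : ∀ U ∈ 𝒰, IsOpen U) (hc : ⋃₀ 𝒰 = Set.univ) (t : T) :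
    HasOpenPartition 𝒰 (raySet t) := by
  by_contra hbad
  let B : Set T := {s | ¬ HasOpenPartition 𝒰 (raySet s)}
  have hB : ∀ {s w : T}, s ≤ w → w ∈ B → s ∈ B :=
    fun hsw hw hs => hw (hs.mono (isClopen_raySet _).2 (raySet_anti hsw))
  obtain ⟨r, hr⟩ := hT.1
  let C : Set B := maxChain (· ≤ ·)
  have hC : IsMaxChain (· ≤ ·) C := maxChain_spec
  have hmax : ∀ s : B, (∀ w ∈ C, s ≤ w ∨ w ≤ s) → s ∈ C := by
    intro s hs
    rw [hC.2 (hC.1.insert fun w hw _ => hs w hw) (subset_insert s C)]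
    exact mem_insert s C
  have hpath : IsPath (Subtype.val '' C) := by
    refine ⟨?_, ?_⟩
    · rintro _ ⟨a, ha, rfl⟩ _ ⟨b, hb, rfl⟩ _
      exact hC.1.total ha hb
    · rintro s _ hs ⟨w, hw, rfl⟩
      refine ⟨⟨s, hB hs w.2⟩, hmax _ fun v hv => ?_, rfl⟩
      rcases hC.1.total hv hw with h | h
      · exact (hT.2 w.1).1.total hs h
      · exact Or.inl (hs.trans h)
  have hray : IsRay (Subtype.val '' C) := by
    refine ⟨hpath, ?_⟩
    rintro _ ⟨w, hw, rfl⟩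
    by_contra! hlast
    apply w.2
    rw [raySet_eq_iUnion_successors hT w.1]
    refine .iUnion (fun s => ?_) (disjoint_raySet_successors w.1)
    by_contra hs
    refine hlast s ⟨⟨s, hs⟩, hmax _ fun v hv => Or.inr ?_, rfl⟩ s.2.1
    rcases hC.1.total hv hw with h | h
    · exact h.trans s.2.1.le
    · have hvw : w.1 = v.1 := eq_of_le_of_not_lt h (hlast v ⟨v, hv, rfl⟩)
      exact hvw.symm.trans_le s.2.1.le
  let x : RaySpace T := ⟨Subtype.val '' C, hray⟩
  have hne : x.1.Nonempty :=
    ⟨r, ⟨r, hB (hr t) hbad⟩, hmax _ fun v _ => Or.inl (hr v), rfl⟩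
  have habove : ∀ s ∉ x.1, (∀ w ∈ x.1, w ≤ s) → HasOpenPartition 𝒰 (raySet s) := by
    intro s hsx hs
    by_contra hsB
    exact hsx ⟨⟨s, hsB⟩, hmax _ fun v hv => Or.inr (hs v ⟨v, hv, rfl⟩), rfl⟩
  obtain ⟨U, hU, hxU⟩ : x ∈ ⋃₀ 𝒰 := hc ▸ mem_univ x
  obtain ⟨_, ⟨w, _, rfl⟩, G, hGc, hG, hwG⟩ :=
    exists_raySet_subset_union x hne habove (ho U hU) hxU
  exact w.2 ((hG.union hGc.1 (.of_subset (ho U hU) hU Subset.rfl) (ho U hU)).mono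
    (isClopen_raySet _).2 hwG)

end RaySpace

/-- Every ray space `R(T)` is ultraparacompact: every open cover can be
refined to a cover by pairwise disjoint open sets. -/
theorem stmt6 {T : Type u} [PartialOrder T] (hT : IsOrderTree T) :
    ∀ 𝒰 : Set (Set (RaySpace T)), (∀ U ∈ 𝒰, IsOpen U) → ⋃₀ 𝒰 = Set.univ →
      ∃ 𝒱 : Set (Set (RaySpace T)), (∀ V ∈ 𝒱, IsOpen V) ∧ ⋃₀ 𝒱 = Set.univ ∧
        𝒱.Pairwise Disjoint ∧ ∀ V ∈ 𝒱, ∃ U ∈ 𝒰, V ⊆ U := by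
  intro 𝒰 ho hc
  obtain ⟨r, hr⟩ := hT.1
  have hempty : IsRay (∅ : Set T) := ⟨⟨by simp [IsChain], by simp⟩, by simp⟩
  obtain ⟨U, hU, hxU⟩ : (⟨∅, hempty⟩ : RaySpace T) ∈ ⋃₀ 𝒰 := hc ▸ mem_univ _
  have hsub : (raySet r)ᶜ ⊆ U := by
    intro y hy
    have hy' : y = ⟨∅, hempty⟩ :=
      Subtype.ext (eq_empty_of_forall_notMem fun t ht => hy (y.2.1.2 (hr t) ht))
    rwa [hy']
  have hclopen := RaySpace.isClopen_raySet r
  have := (RaySpace.hasOpenPartition_raySet hT ho hc r).union hclopen.1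
    (.of_subset hclopen.compl.2 hU hsub) hclopen.compl.2
  rwa [union_compl_self] at this
end

section
/- Let X be a set and let S be a nested, noetherian collection of subsets of X such that X ∈ S and ∅ ∉ S. Then S, partially ordered by reverse inclusion ⊇, is an order tree with root X (i.e., it has unique minimal element X and the set of predecessors of each element is well-ordered); moreover, this tree is special (a union of countably many antichains) if and only if S is σ-disjoint. -/
open Set Topology

universe u v

theorem NoetherianFam.wellFoundedGT {X : Type v} {S : Set (Set X)} (h : NoetherianFam S) :
    WellFoundedGT S := by
  rw [wellFoundedGT_iff_monotone_chain_condition]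
  intro a
  obtain ⟨N, hN⟩ := h (fun n => (a n : Set X)) (fun n => (a n).2) fun _ _ hmn => a.monotone hmn
  exact ⟨N, fun m hm => Subtype.ext (hN m hm).symm⟩

theorem NestedFam.isChain_Iic {X : Type v} {S : Set (Set X)} (hS : NestedFam S)
    (hempty : ∅ ∉ S) (t : (↥S)ᵒᵈ) : IsChain (· ≤ ·) (Set.Iic t) := by
  intro a ha b hb _
  obtain ⟨x, hx⟩ : (OrderDual.ofDual t).1.Nonempty :=
    Set.nonempty_iff_ne_empty.2 fun h => hempty (h ▸ (OrderDual.ofDual t).2)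
  exact (hS _ (OrderDual.ofDual a).2 _ (OrderDual.ofDual b).2 ⟨x, ha hx, hb hx⟩).symm

theorem NestedFam.sigmaDisjointFam {X : Type v} {S : Set (Set X)} (hS : NestedFam S)
    (h : IsSpecialTree (↥S)ᵒᵈ) : SigmaDisjointFam S := by
  obtain ⟨A, hA, hcover⟩ := h
  refine ⟨fun n => {B | ∃ hB : B ∈ S, OrderDual.toDual (⟨B, hB⟩ : S) ∈ A n}, ?_, ?_⟩
  · rintro n B ⟨hB, hBA⟩ C ⟨hC, hCA⟩ hne
    by_contra hdisj
    rcases hS B hB C hC (Set.not_disjoint_iff_nonempty_inter.1 hdisj) with hle | hle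
    · exact hne (congrArg (fun t => ((OrderDual.ofDual t : S) : Set X))
        ((hA n).eq hCA hBA hle)).symm
    · exact hne (congrArg (fun t => ((OrderDual.ofDual t : S) : Set X))
        ((hA n).eq hBA hCA hle))
  · ext B
    refine ⟨fun hB => ?_, fun hB => ?_⟩
    · obtain ⟨n, hB, -⟩ := Set.mem_iUnion.1 hB
      exact hB
    · obtain ⟨n, hn⟩ := Set.mem_iUnion.1
        (hcover.ge (Set.mem_univ (OrderDual.toDual (⟨B, hB⟩ : S))))
      exact Set.mem_iUnion.2 ⟨n, hB, hn⟩

theorem SigmaDisjointFam.isSpecialTree {X : Type v} {S : Set (Set X)} (h : SigmaDisjointFam S)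
    (hempty : ∅ ∉ S) : IsSpecialTree (↥S)ᵒᵈ := by
  obtain ⟨D, hD, hcover⟩ := h
  refine ⟨fun n => {t | (OrderDual.ofDual t).1 ∈ D n}, ?_, ?_⟩
  · intro n s hs t ht hne hle
    have hdisj := hD n hs ht fun h => hne (OrderDual.ofDual.injective (Subtype.ext h))
    have ht_empty : (OrderDual.ofDual t).1 = ∅ := hdisj.eq_bot_of_ge hle
    exact hempty (ht_empty ▸ (OrderDual.ofDual t).2)
  · refine Set.eq_univ_of_forall fun t => ?_
    obtain ⟨n, hn⟩ := Set.mem_iUnion.1 (hcover.ge (OrderDual.ofDual t).2)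
    exact Set.mem_iUnion.2 ⟨n, hn⟩

/-- A nested, noetherian collection `S` of subsets of `X` with `X ∈ S` and
`∅ ∉ S`, ordered by reverse inclusion, is an order tree with root `X`; this tree is
special iff `S` is σ-disjoint. -/
theorem stmt12 {X : Type u} (S : Set (Set X)) (hnested : NestedFam S)
    (hnoeth : NoetherianFam S) (huniv : Set.univ ∈ S) (hempty : ∅ ∉ S) :
    IsOrderTree (↥S)ᵒᵈ ∧
    (∀ A : (↥S)ᵒᵈ, OrderDual.toDual (⟨Set.univ, huniv⟩ : ↥S) ≤ A) ∧
    (IsSpecialTree (↥S)ᵒᵈ ↔ SigmaDisjointFam S) := by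
  have := hnoeth.wellFoundedGT
  have hroot : ∀ A : (↥S)ᵒᵈ, OrderDual.toDual (⟨Set.univ, huniv⟩ : ↥S) ≤ A :=
    fun A => Set.subset_univ (OrderDual.ofDual A).1
  exact ⟨⟨⟨_, hroot⟩, fun t => ⟨hnested.isChain_Iic hempty t, Set.IsWF.of_wellFoundedLT _⟩⟩,
    hroot, hnested.sigmaDisjointFam, fun h => h.isSpecialTree hempty⟩
end
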